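/- Let d and k be integers with 3 ≤ k ≤ d/2. For every N₀ there exist N ≥ N₀ and a centrally symmetric d-polytope P ⊂ ℝ^d with N vertices whose number of (k−1)-dimensional faces satisfies f_{k−1}(P) ≥ (1 − k² · 2^{−3d/(20 k² 2^k)}) · C(N,k). -/

import Mathlib

open Set

/-- A polytope: the convex hull of a finite set of points. -/
def IsPolytope {E : Type*} [AddCommGroup E] [Module ℝ E] (P : Set E) : Prop :=
  ∃ V : Finset E, P = convexHull ℝ (V : Set E)

/-- A (nonempty, proper) exposed face of `P`. -/
def IsProperFace {E : Type*} [AddCommGroup E] [Module ℝ E] [TopologicalSpace E]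
    (P F : Set E) : Prop :=
  F.Nonempty ∧ F ≠ P ∧ IsExposed ℝ P F

/-- The number of `j`-dimensional proper faces of `P`. -/
noncomputable def faceCount {d : ℕ} (P : Set (Fin d → ℝ)) (j : ℕ) : ℕ :=
  Set.ncard {F : Set (Fin d → ℝ) |
    IsProperFace P F ∧ Module.finrank ℝ (affineSpan ℝ F).direction = j}

/-- `S` is the set of points of `W` at which some linear functional is maximal over `W`. -/
def IsSupported {E : Type*} [AddCommGroup E] [Module ℝ E] (W S : Set E) : Prop :=
  ∃ (l : E →ₗ[ℝ] ℝ) (c : ℝ), (∀ v ∈ S, l v = c) ∧ ∀ v ∈ W, v ∉ S → l v < c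

theorem le_of_mem_convexHull {E : Type*} [AddCommGroup E] [Module ℝ E] {W : Set E}
    {l : E →ₗ[ℝ] ℝ} {c : ℝ} (h : ∀ v ∈ W, l v ≤ c) {x : E} (hx : x ∈ convexHull ℝ W) :
    l x ≤ c :=
  convexHull_min (t := {x | l x ≤ c}) h (convex_halfSpace_le l.isLinear c) hx

theorem eq_of_mem_convexHull {E : Type*} [AddCommGroup E] [Module ℝ E] {W : Set E}
    {l : E →ₗ[ℝ] ℝ} {c : ℝ} (h : ∀ v ∈ W, l v = c) {x : E} (hx : x ∈ convexHull ℝ W) :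
    l x = c :=
  convexHull_min (t := {x | l x = c}) h (convex_hyperplane l.isLinear c) hx

theorem mem_convexHull_subset_of_le {E : Type*} [AddCommGroup E] [Module ℝ E]
    {W S : Finset E} (hSW : S ⊆ W) {l : E →ₗ[ℝ] ℝ} {c : ℝ} (h₁ : ∀ v ∈ S, l v = c)
    (h₂ : ∀ v ∈ W, v ∉ S → l v < c) {x : E} (hx : x ∈ convexHull ℝ (W : Set E))
    (hc : c ≤ l x) : x ∈ convexHull ℝ (S : Set E) := by
  rw [Finset.mem_convexHull'] at hx ⊢
  obtain ⟨w, hw0, hw1, rfl⟩ := hx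
  have hle : ∀ y ∈ W, 0 ≤ w y * (c - l y) := fun y hy => by
    refine mul_nonneg (hw0 y hy) ?_
    by_cases hyS : y ∈ S
    · simp [h₁ y hyS]
    · linarith [h₂ y hy hyS]
  have hsum : ∑ y ∈ W, w y * (c - l y) = 0 := by
    refine le_antisymm ?_ (Finset.sum_nonneg hle)
    simp only [map_sum, map_smul, smul_eq_mul] at hc
    simp only [mul_sub, Finset.sum_sub_distrib, ← Finset.sum_mul, hw1]
    linarith
  have hz : ∀ y ∈ W, y ∉ S → w y = 0 := fun y hy hyS => by
    have := (Finset.sum_eq_zero_iff_of_nonneg hle).1 hsum y hy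
    rcases mul_eq_zero.1 this with h | h
    · exact h
    · linarith [h₂ y hy hyS]
  refine ⟨w, fun y hy => hw0 y (hSW hy), ?_, ?_⟩
  · rw [← hw1]
    exact Finset.sum_subset hSW hz
  · exact Finset.sum_subset hSW fun y hy hyS => by rw [hz y hy hyS, zero_smul]

theorem IsSupported.isExposed_convexHull {E : Type*} [AddCommGroup E] [Module ℝ E]
    [TopologicalSpace E] [IsTopologicalAddGroup E] [ContinuousSMul ℝ E] [T2Space E]
    [FiniteDimensional ℝ E] {W S : Finset E} (hSW : S ⊆ W) (hS : S.Nonempty)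
    (h : IsSupported (W : Set E) S) :
    IsExposed ℝ (convexHull ℝ (W : Set E)) (convexHull ℝ (S : Set E)) := by
  obtain ⟨l, c, h₁, h₂⟩ := h
  obtain ⟨s, hs⟩ := hS
  have hle : ∀ v ∈ (W : Set E), l v ≤ c := fun v hv => by
    by_cases hvS : v ∈ S
    · exact (h₁ v hvS).le
    · exact (h₂ v hv hvS).le
  refine fun _ => ⟨LinearMap.toContinuousLinearMap l, ?_⟩
  ext x
  simp only [LinearMap.coe_toContinuousLinearMap', mem_ofPred_eq]
  refine ⟨fun hx => ⟨convexHull_mono (by exact_mod_cast hSW) hx, fun y hy => ?_⟩, fun hx => ?_⟩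
  · rw [eq_of_mem_convexHull h₁ hx]
    exact le_of_mem_convexHull hle hy
  · refine mem_convexHull_subset_of_le hSW h₁ h₂ hx.1 ?_
    rw [← h₁ s hs]
    exact hx.2 s (subset_convexHull ℝ _ (hSW hs))

theorem IsSupported.mem_of_mem_convexHull {E : Type*} [AddCommGroup E] [Module ℝ E]
    {W S : Set E} (h : IsSupported W S) {w : E} (hw : w ∈ W)
    (hwS : w ∈ convexHull ℝ S) : w ∈ S := by
  obtain ⟨l, c, h₁, h₂⟩ := h
  by_contra hn
  exact (h₂ w hw hn).ne (eq_of_mem_convexHull h₁ hwS)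

theorem extremePoints_convexHull_of_isSupported {E : Type*} [AddCommGroup E] [Module ℝ E]
    [TopologicalSpace E] [IsTopologicalAddGroup E] [ContinuousSMul ℝ E] [T2Space E]
    [FiniteDimensional ℝ E] {W : Finset E} (h : ∀ w ∈ W, IsSupported (W : Set E) {w}) :
    (convexHull ℝ (W : Set E)).extremePoints ℝ = W := by
  refine Subset.antisymm (extremePoints_convexHull_subset (𝕜 := ℝ)) fun w hw => ?_
  have := IsSupported.isExposed_convexHull (E := E) (W := W) (S := {w}) (by simpa using hw) (by simp)
    (by simpa using h w hw)
  rw [Finset.coe_singleton, convexHull_singleton] at this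
  exact this.isExtreme.extremePoints_subset_extremePoints (by simp)

theorem finite_setOf_isExposed_convexHull {E : Type*} [AddCommGroup E] [Module ℝ E]
    [TopologicalSpace E] [IsTopologicalAddGroup E] [ContinuousSMul ℝ E] [T2Space E]
    [LocallyConvexSpace ℝ E] (W : Finset E) :
    {F : Set E | IsExposed ℝ (convexHull ℝ (W : Set E)) F}.Finite := by
  have hc : IsCompact (convexHull ℝ (W : Set E)) := W.finite_toSet.isCompact_convexHull ℝ
  refine Finite.of_finite_image (f := fun F => F.extremePoints ℝ)
    (W.finite_toSet.finite_subsets.subset ?_) ?_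
  · rintro _ ⟨F, hF, rfl⟩
    exact hF.isExtreme.extremePoints_subset_extremePoints.trans extremePoints_convexHull_subset
  · intro F hF G hG hFG
    rw [← closure_convexHull_extremePoints (hF.isCompact hc) (hF.convex (convex_convexHull ℝ _)),
      ← closure_convexHull_extremePoints (hG.isCompact hc) (hG.convex (convex_convexHull ℝ _))]
    exact congrArg (fun s => closure (convexHull ℝ s)) hFG

theorem affineSpan_convexHull_eq_top_of_neg_mem {E : Type*} [AddCommGroup E] [Module ℝ E]
    {W : Set E} (hne : W.Nonempty) (hneg : ∀ w ∈ W, -w ∈ W) (hspan : Submodule.span ℝ W = ⊤) :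
    affineSpan ℝ (convexHull ℝ W) = ⊤ := by
  rw [affineSpan_convexHull,
    AffineSubspace.affineSpan_eq_top_iff_vectorSpan_eq_top_of_nonempty ℝ E E hne, eq_top_iff,
    ← hspan, Submodule.span_le]
  intro w hw
  have := Submodule.smul_mem _ (1 / 2 : ℝ) (vsub_mem_vectorSpan ℝ hw (hneg w hw))
  rw [vsub_eq_sub, sub_neg_eq_add, ← two_smul ℝ w, smul_smul] at this
  simpa using this

theorem finrank_direction_affineSpan_convexHull {E : Type*} [AddCommGroup E] [Module ℝ E]
    {S : Finset E} {n : ℕ} (hS : LinearIndependent ℝ ((↑) : S → E)) (hn : S.card = n + 1) :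
    Module.finrank ℝ (affineSpan ℝ (convexHull ℝ (S : Set E))).direction = n := by
  rw [affineSpan_convexHull, direction_affineSpan]
  have hr : range ((↑) : S → E) = S := by ext; simp
  rw [← hr]
  exact hS.affineIndependent.finrank_vectorSpan (by simpa using hn)

theorem card_le_faceCount {d n : ℕ} {W : Finset (Fin d → ℝ)} (hneg : ∀ w ∈ W, -w ∈ W)
    (𝒮 : Finset (Finset (Fin d → ℝ))) (hsub : ∀ S ∈ 𝒮, S ⊆ W) (hcard : ∀ S ∈ 𝒮, S.card = n + 1)
    (hlin : ∀ S ∈ 𝒮, LinearIndependent ℝ ((↑) : S → Fin d → ℝ))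
    (hsupp : ∀ S ∈ 𝒮, IsSupported (W : Set (Fin d → ℝ)) S) :
    𝒮.card ≤ faceCount (convexHull ℝ (W : Set (Fin d → ℝ))) n := by
  have hinj : InjOn (fun S : Finset (Fin d → ℝ) => convexHull ℝ (S : Set (Fin d → ℝ))) 𝒮 := by
    have key : ∀ S ∈ 𝒮, ∀ T ∈ 𝒮, convexHull ℝ (S : Set (Fin d → ℝ)) = convexHull ℝ T → S ⊆ T :=
      fun S hS T hT h v hv => (hsupp T hT).mem_of_mem_convexHull (hsub S hS hv)
        (h ▸ subset_convexHull ℝ _ hv)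
    exact fun S hS T hT h => (key S hS T hT h).antisymm (key T hT S hS h.symm)
  rw [← Set.ncard_coe_finset, ← hinj.ncard_image]
  refine Set.ncard_le_ncard ?_ ((finite_setOf_isExposed_convexHull W).subset fun F hF => hF.1.2.2)
  rintro _ ⟨S, hS, rfl⟩
  have hSne : S.Nonempty := Finset.card_pos.1 (by rw [hcard S hS]; omega)
  refine ⟨⟨hSne.to_set.convexHull, fun heq => ?_,
    (hsupp S hS).isExposed_convexHull (hsub S hS) hSne⟩,
    finrank_direction_affineSpan_convexHull (hlin S hS) (hcard S hS)⟩
  obtain ⟨s, hs⟩ := hSne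
  have hmem : -s ∈ S := (hsupp S hS).mem_of_mem_convexHull (hneg s (hsub S hS hs)) (by
    simp only at heq
    rw [heq]
    exact subset_convexHull ℝ _ (hneg s (hsub S hS hs)))
  have hs0 : s ≠ 0 := (hlin S hS).ne_zero ⟨s, hs⟩
  have hne : (⟨s, hs⟩ : S) ≠ ⟨-s, hmem⟩ := fun h => hs0 (self_eq_neg.1 (congrArg Subtype.val h))
  have hp := (LinearIndepOn.pair_iff _ hne).1 ((hlin S hS).linearIndepOn _) (1 : ℝ) 1
  simpa using hp (by simp)

/-- The sign attached to a Boolean. -/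
def boolSign (b : Bool) : ℝ := if b then 1 else -1

theorem boolSign_mul_self (b : Bool) : boolSign b * boolSign b = 1 := by
  cases b <;> simp [boolSign]

theorem abs_boolSign (b : Bool) : |boolSign b| = 1 := by
  cases b <;> simp [boolSign]

theorem boolSign_mul_of_ne {b c : Bool} (h : b ≠ c) : boolSign b * boolSign c = -1 := by
  cases b <;> cases c <;> simp_all [boolSign]

theorem boolSign_not (b : Bool) : boolSign (!b) = -boolSign b := by
  cases b <;> simp [boolSign]

/-- First coordinate of a rational parametrization of the unit circle. -/
noncomputable def circleX (t : ℕ) : ℝ := (1 - (t : ℝ) ^ 2) / (1 + (t : ℝ) ^ 2)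

/-- Second coordinate of a rational parametrization of the unit circle. -/
noncomputable def circleY (t : ℕ) : ℝ := 2 * t / (1 + (t : ℝ) ^ 2)

theorem circleX_sq_add_circleY_sq (t : ℕ) : circleX t ^ 2 + circleY t ^ 2 = 1 := by
  have : (1 + (t : ℝ) ^ 2) ≠ 0 := by positivity
  rw [circleX, circleY]
  field_simp
  ring

theorem circleX_injective : Function.Injective circleX := fun s t h => by
  have hs : (1 + (s : ℝ) ^ 2) ≠ 0 := by positivity
  have ht : (1 + (t : ℝ) ^ 2) ≠ 0 := by positivity
  rw [circleX, circleX, div_eq_div_iff hs ht] at h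
  have h2 : (s : ℝ) ^ 2 = (t : ℝ) ^ 2 := by linarith
  exact_mod_cast (sq_eq_sq₀ (by positivity) (by positivity)).1 h2

theorem circle_inner_lt_one {s t : ℕ} (h : s ≠ t) :
    circleX s * circleX t + circleY s * circleY t < 1 := by
  have h1 := circleX_sq_add_circleY_sq s
  have h2 := circleX_sq_add_circleY_sq t
  have h3 : 0 < (circleX s - circleX t) ^ 2 :=
    sq_pos_iff.2 (sub_ne_zero.2 fun e => h (circleX_injective e))
  nlinarith [sq_nonneg (circleY s - circleY t)]

theorem neg_one_le_circle_inner (s t : ℕ) :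
    -1 ≤ circleX s * circleX t + circleY s * circleY t := by
  nlinarith [circleX_sq_add_circleY_sq s, circleX_sq_add_circleY_sq t,
    sq_nonneg (circleX s + circleX t), sq_nonneg (circleY s + circleY t)]

/-- Signed copies of a cluster of `M` points on an ellipse centred at `x i`, for every `i`. -/
noncomputable def clusterPoint {I E₁ E₂ : Type*} [AddCommGroup E₁] [Module ℝ E₁]
    [AddCommGroup E₂] [Module ℝ E₂] {M : ℕ} (x : I → E₁) (y : I → E₂)
    (r : I × Bool × Fin M) : E₁ × E₂ × E₂ :=
  boolSign r.2.1 • (x r.1, circleX r.2.2 • y r.1, circleY r.2.2 • y r.1)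

section Cluster

variable {I E₁ E₂ : Type*} [AddCommGroup E₁] [Module ℝ E₁]
    [AddCommGroup E₂] [Module ℝ E₂] {M κ : ℕ} {x : I → E₁} {y : I → E₂}

theorem coprod_clusterPoint (f : E₁ →ₗ[ℝ] ℝ) (g h : E₂ →ₗ[ℝ] ℝ) (r : I × Bool × Fin M) :
    (f.coprod (g.coprod h)) (clusterPoint x y r) = boolSign r.2.1 *
      (f (x r.1) + (circleX r.2.2 * g (y r.1) + circleY r.2.2 * h (y r.1))) := by
  simp [clusterPoint, mul_add]

theorem exists_section {A B : Type*} {R : Finset (A × B)} (hR : R.Nonempty)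
    (hinj : Set.InjOn Prod.fst (R : Set (A × B))) : ∃ ρ : A → B, ∀ r ∈ R, ρ r.1 = r.2 := by
  classical
  obtain ⟨r₀, -⟩ := hR
  refine ⟨fun a => if h : ∃ b, (a, b) ∈ R then h.choose else r₀.2, fun r hr => ?_⟩
  have h : ∃ b, (r.1, b) ∈ R := ⟨r.2, hr⟩
  simp only [dif_pos h]
  exact congrArg Prod.snd (hinj h.choose_spec hr rfl)

theorem exists_pos_forall_add_mul_lt {K : Type*} [Finite K] (u v : K → ℝ) (hu : ∀ i, u i < 1) :
    ∃ η : ℝ, 0 < η ∧ ∀ i, u i + η * v i < 1 := by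
  have h : ∀ᶠ η in nhdsWithin (0 : ℝ) (Ioi 0), ∀ i, u i + η * v i < 1 := by
    rw [Filter.eventually_all]
    intro i
    refine nhdsWithin_le_nhds ?_
    have hc : Continuous fun η : ℝ => u i + η * v i := by fun_prop
    exact hc.continuousAt.eventually (Iio_mem_nhds (by simpa using hu i))
  obtain ⟨η, h₁, h₂⟩ := (h.and self_mem_nhdsWithin).exists
  exact ⟨η, h₂, h₁⟩

theorem exists_functional_clusterPoint [Finite I]
    (hx : ∀ J : Finset I, J.card ≤ κ → ∀ σ : I → ℝ, (∀ i, |σ i| ≤ 1) →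
      ∃ f : E₁ →ₗ[ℝ] ℝ, (∀ j ∈ J, f (x j) = σ j) ∧ ∀ i ∉ J, |f (x i)| < 1)
    (hy : ∀ J : Finset I, J.card ≤ κ → ∀ c : I → ℝ, ∃ g : E₂ →ₗ[ℝ] ℝ, ∀ j ∈ J, g (y j) = c j)
    {R : Finset (I × Bool × Fin M)} (hR : R.Nonempty) (hcard : R.card ≤ κ)
    (hinj : Set.InjOn Prod.fst (R : Set (I × Bool × Fin M))) :
    ∃ (l : E₁ × E₂ × E₂ →ₗ[ℝ] ℝ) (c : ℝ), (∀ r ∈ R, l (clusterPoint x y r) = c) ∧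
      ∀ r ∉ R, l (clusterPoint x y r) < c := by
  classical
  obtain ⟨ρ, hρ⟩ := exists_section hR hinj
  set J : Finset I := R.image Prod.fst with hJ
  have hJc : J.card ≤ κ := Finset.card_image_le.trans hcard
  obtain ⟨f, hf₁, hf₂⟩ := hx J hJc (fun i => boolSign (ρ i).1) fun i => (abs_boolSign _).le
  obtain ⟨g, hg⟩ := hy J hJc fun i => boolSign (ρ i).1 * circleX (ρ i).2
  obtain ⟨h, hh⟩ := hy J hJc fun i => boolSign (ρ i).1 * circleY (ρ i).2
  obtain ⟨η, hη, hlt⟩ := exists_pos_forall_add_mul_lt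
    (K := {i // i ∉ J} × Fin M) (fun p => |f (x p.1)|)
    (fun p => |circleX p.2 * g (y p.1) + circleY p.2 * h (y p.1)|) fun p => hf₂ p.1 p.1.2
  refine ⟨f.coprod ((η • g).coprod (η • h)), 1 + η, fun r hr => ?_, fun r hr => ?_⟩
  · have hrJ : r.1 ∈ J := Finset.mem_image_of_mem _ hr
    rw [coprod_clusterPoint, LinearMap.smul_apply, LinearMap.smul_apply, hf₁ _ hrJ, hg _ hrJ,
      hh _ hrJ, hρ r hr, smul_eq_mul, smul_eq_mul]
    linear_combination (1 + η * (circleX r.2.2 ^ 2 + circleY r.2.2 ^ 2)) * boolSign_mul_self r.2.1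
      + η * circleX_sq_add_circleY_sq r.2.2
  · rw [coprod_clusterPoint, LinearMap.smul_apply, LinearMap.smul_apply, smul_eq_mul, smul_eq_mul]
    by_cases hrJ : r.1 ∈ J
    · have hne : r.2 ≠ ρ r.1 := by
        rintro he
        obtain ⟨r', hr', h1⟩ := Finset.mem_image.1 hrJ
        have : r' = r := Prod.ext h1 (by rw [he, ← h1, hρ r' hr'])
        exact hr (this ▸ hr')
      rw [hf₁ _ hrJ, hg _ hrJ, hh _ hrJ]
      have hrw : boolSign r.2.1 * (boolSign (ρ r.1).1 +
          (circleX r.2.2 * (η * (boolSign (ρ r.1).1 * circleX (ρ r.1).2)) +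
            circleY r.2.2 * (η * (boolSign (ρ r.1).1 * circleY (ρ r.1).2)))) =
          boolSign r.2.1 * boolSign (ρ r.1).1 * (1 + η *
            (circleX r.2.2 * circleX (ρ r.1).2 + circleY r.2.2 * circleY (ρ r.1).2)) := by
        ring
      rw [hrw]
      by_cases hb : r.2.1 = (ρ r.1).1
      · have ht : (r.2.2 : ℕ) ≠ (ρ r.1).2 := fun he => hne (Prod.ext hb (Fin.ext he))
        rw [hb, boolSign_mul_self]
        nlinarith [circle_inner_lt_one ht]
      · rw [boolSign_mul_of_ne hb]
        nlinarith [neg_one_le_circle_inner r.2.2 (ρ r.1).2]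
    · refine (le_abs_self _).trans_lt ?_
      rw [abs_mul, abs_boolSign, one_mul]
      have h1 := hlt (⟨r.1, hrJ⟩, r.2.2)
      simp only at h1
      refine (abs_add_le _ _).trans_lt ?_
      have h2 : circleX r.2.2 * (η * g (y r.1)) + circleY r.2.2 * (η * h (y r.1)) =
        η * (circleX r.2.2 * g (y r.1) + circleY r.2.2 * h (y r.1)) := by ring
      rw [h2, abs_mul, abs_of_pos hη]
      linarith

theorem linearIndependent_clusterPoint
    (hy : ∀ J : Finset I, J.card ≤ κ → ∀ c : I → ℝ, ∃ g : E₂ →ₗ[ℝ] ℝ, ∀ j ∈ J, g (y j) = c j)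
    {R : Finset (I × Bool × Fin M)} (hcard : R.card ≤ κ)
    (hinj : Set.InjOn Prod.fst (R : Set (I × Bool × Fin M))) :
    LinearIndependent ℝ fun r : R => clusterPoint x y r.1 := by
  classical
  rw [Fintype.linearIndependent_iff]
  intro c hc r₀
  have hJc : (R.image Prod.fst).card ≤ κ := Finset.card_image_le.trans hcard
  obtain ⟨g, hg⟩ := hy _ hJc fun i => if i = r₀.1.1 then circleX r₀.1.2.2 else 0
  obtain ⟨h, hh⟩ := hy _ hJc fun i => if i = r₀.1.1 then circleY r₀.1.2.2 else 0
  have := congrArg ((0 : E₁ →ₗ[ℝ] ℝ).coprod (g.coprod h)) hc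
  simp only [map_sum, map_smul, coprod_clusterPoint, map_zero] at this
  rw [Finset.sum_eq_single r₀] at this
  · rw [hg _ (Finset.mem_image_of_mem _ r₀.2), hh _ (Finset.mem_image_of_mem _ r₀.2), if_pos rfl,
      if_pos rfl, LinearMap.zero_apply, zero_add, ← sq, ← sq, circleX_sq_add_circleY_sq,
      smul_eq_mul, mul_one] at this
    refine (mul_eq_zero.1 this).resolve_right fun h0 => ?_
    simpa [h0] using abs_boolSign r₀.1.2.1
  · intro r _ hr
    have hne : r.1.1 ≠ r₀.1.1 := fun he => hr (Subtype.ext (hinj r.2 r₀.2 he))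
    rw [hg _ (Finset.mem_image_of_mem _ r.2), hh _ (Finset.mem_image_of_mem _ r.2), if_neg hne,
      if_neg hne]
    simp
  · simp

theorem span_range_clusterPoint (hM : 3 ≤ M) (hx : Submodule.span ℝ (range x) = ⊤)
    (hy : Submodule.span ℝ (range y) = ⊤) :
    Submodule.span ℝ (range (clusterPoint (M := M) x y)) = ⊤ := by
  by_contra hne
  obtain ⟨l, hl0, hl⟩ := Submodule.exists_le_ker_of_lt_top _ (lt_top_iff_ne_top.2 hne)
  refine hl0 ?_
  obtain ⟨f, g, h, rfl⟩ : ∃ (f : E₁ →ₗ[ℝ] ℝ) (g h : E₂ →ₗ[ℝ] ℝ), l = f.coprod (g.coprod h) :=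
    ⟨l.comp (LinearMap.inl ℝ _ _), (l.comp (LinearMap.inr ℝ _ _)).comp (LinearMap.inl ℝ _ _),
      (l.comp (LinearMap.inr ℝ _ _)).comp (LinearMap.inr ℝ _ _), by
        rw [← LinearMap.comp_coprod, LinearMap.coprod_inl_inr, LinearMap.comp_id,
          ← LinearMap.comp_coprod, LinearMap.coprod_inl_inr, LinearMap.comp_id]⟩
  have key : ∀ i, ∀ t < M, f (x i) + (circleX t * g (y i) + circleY t * h (y i)) = 0 := by
    intro i t ht
    have := hl (Submodule.subset_span ⟨(i, true, ⟨t, ht⟩), rfl⟩)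
    rw [LinearMap.mem_ker, coprod_clusterPoint] at this
    simpa [boolSign] using this
  have hall : ∀ i, f (x i) = 0 ∧ g (y i) = 0 ∧ h (y i) = 0 := by
    intro i
    have h0 := key i 0 (by omega)
    have h1 := key i 1 (by omega)
    have h2 := key i 2 (by omega)
    norm_num [circleX, circleY] at h0 h1 h2
    refine ⟨?_, ?_, ?_⟩ <;> linarith
  have hf : f = 0 := LinearMap.ext_on_range hx fun i => by simpa using (hall i).1
  have hg : g = 0 := LinearMap.ext_on_range hy fun i => by simpa using (hall i).2.1
  have hh : h = 0 := LinearMap.ext_on_range hy fun i => by simpa using (hall i).2.2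
  subst hf hg hh
  ext <;> simp

theorem clusterPoint_not (r : I × Bool × Fin M) :
    clusterPoint x y (r.1, !r.2.1, r.2.2) = -clusterPoint x y r := by
  simp only [clusterPoint, boolSign_not, neg_smul]

end Cluster

theorem exists_polytope_of_clusters {d n M : ℕ} {I E₁ E₂ : Type*} [Fintype I] [Nonempty I]
    [AddCommGroup E₁] [Module ℝ E₁] [FiniteDimensional ℝ E₁]
    [AddCommGroup E₂] [Module ℝ E₂] [FiniteDimensional ℝ E₂] {x : I → E₁} {y : I → E₂}
    (hd : Module.finrank ℝ E₁ + 2 * Module.finrank ℝ E₂ = d) (hM : 3 ≤ M)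
    (hx : ∀ J : Finset I, J.card ≤ n + 1 → ∀ σ : I → ℝ, (∀ i, |σ i| ≤ 1) →
      ∃ f : E₁ →ₗ[ℝ] ℝ, (∀ j ∈ J, f (x j) = σ j) ∧ ∀ i ∉ J, |f (x i)| < 1)
    (hy : ∀ J : Finset I, J.card ≤ n + 1 → ∀ c : I → ℝ, ∃ g : E₂ →ₗ[ℝ] ℝ, ∀ j ∈ J, g (y j) = c j)
    (hxs : Submodule.span ℝ (range x) = ⊤) (hys : Submodule.span ℝ (range y) = ⊤) :
    ∃ P : Set (Fin d → ℝ), IsPolytope P ∧ P = -P ∧ affineSpan ℝ P = ⊤ ∧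
      (P.extremePoints ℝ).ncard = Fintype.card I * (2 * M) ∧
      {R : Finset (I × Bool × Fin M) | R.card = n + 1 ∧
        Set.InjOn Prod.fst (R : Set (I × Bool × Fin M))}.ncard ≤ faceCount P n := by
  classical
  have hdim : Module.finrank ℝ (E₁ × E₂ × E₂) = Module.finrank ℝ (Fin d → ℝ) := by
    rw [Module.finrank_prod, Module.finrank_prod, Module.finrank_fin_fun]
    omega
  set e := LinearEquiv.ofFinrankEq (R := ℝ) _ _ hdim
  set w : I × Bool × Fin M → Fin d → ℝ := fun r => e (clusterPoint x y r) with hw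
  have hsupp : ∀ R : Finset (I × Bool × Fin M), R.Nonempty → R.card ≤ n + 1 →
      Set.InjOn Prod.fst (R : Set (I × Bool × Fin M)) →
      ∃ (l : (Fin d → ℝ) →ₗ[ℝ] ℝ) (c : ℝ), (∀ r ∈ R, l (w r) = c) ∧ ∀ r ∉ R, l (w r) < c := by
    intro R hR hc hinj
    obtain ⟨l, c, h₁, h₂⟩ := exists_functional_clusterPoint hx hy hR hc hinj
    exact ⟨l.comp e.symm.toLinearMap, c, fun r hr => by simpa [hw] using h₁ r hr,
      fun r hr => by simpa [hw] using h₂ r hr⟩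
  have hwinj : Function.Injective w := by
    intro r s hrs
    by_contra hne
    obtain ⟨l, c, h₁, h₂⟩ := hsupp {r} (by simp) (by simp) (by simp)
    have := h₂ s (by simpa using Ne.symm hne)
    rw [← hrs, h₁ r (by simp)] at this
    exact this.false
  set W : Finset (Fin d → ℝ) := Finset.univ.image w with hW
  have hmem : ∀ r, w r ∈ W := fun r => Finset.mem_image_of_mem _ (Finset.mem_univ r)
  have hWr : (W : Set (Fin d → ℝ)) = range w := by simp [hW]
  have hsuppW : ∀ R : Finset (I × Bool × Fin M), R.Nonempty → R.card ≤ n + 1 →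
      Set.InjOn Prod.fst (R : Set (I × Bool × Fin M)) →
      IsSupported (W : Set (Fin d → ℝ)) (R.image w : Finset (Fin d → ℝ)) := by
    intro R hR hc hinj
    obtain ⟨l, c, h₁, h₂⟩ := hsupp R hR hc hinj
    refine ⟨l, c, fun v hv => ?_, fun v hv hvn => ?_⟩
    · obtain ⟨r, hr, rfl⟩ := Finset.mem_image.1 hv
      exact h₁ r hr
    · rw [hWr] at hv
      obtain ⟨r, rfl⟩ := hv
      exact h₂ r fun hr => hvn (Finset.mem_image_of_mem _ hr)
  have hneg : ∀ v ∈ W, -v ∈ W := by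
    intro v hv
    obtain ⟨r, -, rfl⟩ := Finset.mem_image.1 hv
    have : -w r = w (r.1, !r.2.1, r.2.2) := by simp only [hw, clusterPoint_not, map_neg]
    rw [this]
    exact hmem _
  have hspan : Submodule.span ℝ (W : Set (Fin d → ℝ)) = ⊤ := by
    have hr : range w = e.toLinearMap '' range (clusterPoint (M := M) x y) := by
      rw [← range_comp]
      rfl
    rw [hWr, hr, Submodule.span_image, span_range_clusterPoint hM hxs hys, Submodule.map_top,
      LinearEquiv.range]
  have hne : (W : Set (Fin d → ℝ)).Nonempty := by
    obtain ⟨i⟩ := ‹Nonempty I›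
    exact ⟨_, hmem (i, true, ⟨0, by omega⟩)⟩
  have hnegW : -(W : Set (Fin d → ℝ)) = W := by
    ext v
    exact ⟨fun hv => by simpa using hneg _ hv, fun hv => hneg _ hv⟩
  refine ⟨convexHull ℝ (W : Set (Fin d → ℝ)), ⟨W, rfl⟩, ?_,
    affineSpan_convexHull_eq_top_of_neg_mem hne hneg hspan, ?_, ?_⟩
  · rw [← convexHull_neg, hnegW]
  · rw [extremePoints_convexHull_of_isSupported, Set.ncard_coe_finset, hW,
      Finset.card_image_of_injective _ hwinj, Finset.card_univ]
    · simp
    · intro v hv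
      obtain ⟨r, -, rfl⟩ := Finset.mem_image.1 hv
      simpa using hsuppW {r} (by simp) (by simp) (by simp)
  · set 𝒯 : Finset (Finset (I × Bool × Fin M)) := Finset.univ.filter fun R => R.card = n + 1 ∧
        Set.InjOn Prod.fst (R : Set (I × Bool × Fin M)) with h𝒯
    have hset : {R : Finset (I × Bool × Fin M) | R.card = n + 1 ∧
        Set.InjOn Prod.fst (R : Set (I × Bool × Fin M))} = 𝒯 := by simp [h𝒯]
    rw [hset, Set.ncard_coe_finset, ← Finset.card_image_of_injective 𝒯
      (Finset.image_injective hwinj)]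
    refine card_le_faceCount hneg _ ?_ ?_ ?_ ?_
    all_goals
      intro S hS
      obtain ⟨R, hR, rfl⟩ := Finset.mem_image.1 hS
      obtain ⟨hRc, hRi⟩ := (Finset.mem_filter.1 hR).2
    · exact Finset.image_subset_image (Finset.subset_univ R)
    · rw [Finset.card_image_of_injective _ hwinj, hRc]
    · have h1 := (linearIndependent_clusterPoint (x := x) hy hRc.le hRi).map' e.toLinearMap e.ker
      have h2 : LinearIndepOn ℝ w (R : Set (I × Bool × Fin M)) := h1
      have h3 := h2.id_image
      rw [← Finset.coe_image] at h3
      exact h3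
    · exact hsuppW R (Finset.card_pos.1 (by omega)) hRc.le hRi

theorem exists_functional_vandermonde {I : Type*} {k : ℕ} {s : I → ℝ} (hs : Function.Injective s)
    (J : Finset I) (hJ : J.card ≤ k) (c : I → ℝ) :
    ∃ g : (Fin k → ℝ) →ₗ[ℝ] ℝ, ∀ j ∈ J, g (fun r => s j ^ (r : ℕ)) = c j := by
  classical
  set p := Lagrange.interpolate J s c with hp
  refine ⟨∑ r : Fin k, p.coeff r • LinearMap.proj r, fun j hj => ?_⟩
  have hev : p.eval (s j) = c j := Lagrange.eval_interpolate_at_node c hs.injOn hj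
  have hdeg : p.natDegree < k := by
    have hk : 0 < k := (Finset.card_pos.2 ⟨j, hj⟩).trans_le hJ
    by_cases hp0 : p = 0
    · simpa [hp0] using hk
    · exact ((Polynomial.natDegree_lt_iff_degree_lt hp0).2
        (Lagrange.degree_interpolate_lt c hs.injOn)).trans_le hJ
  rw [← hev, Polynomial.eval_eq_sum_range' hdeg, ← Fin.sum_univ_eq_sum_range
    (fun i => p.coeff i * s j ^ i)]
  simp

theorem span_range_vandermonde {I : Type*} [Fintype I] {k : ℕ} {s : I → ℝ}
    (hs : Function.Injective s) (hk : k ≤ Fintype.card I) :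
    Submodule.span ℝ (range fun i (r : Fin k) => s i ^ (r : ℕ)) = ⊤ := by
  by_contra hne
  obtain ⟨l, hl0, hl⟩ := Submodule.exists_le_ker_of_lt_top _ (lt_top_iff_ne_top.2 hne)
  obtain ⟨φ⟩ : Nonempty (Fin k ↪ I) := Function.Embedding.nonempty_of_card_le (by simpa using hk)
  have h0 := Matrix.eq_zero_of_forall_index_sum_pow_mul_eq_zero (f := fun i => s (φ i))
    (v := fun r => l (Pi.single r 1)) (hs.comp φ.injective) fun j => by
      have h1 : l (fun r : Fin k => s (φ j) ^ (r : ℕ)) = 0 :=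
        LinearMap.mem_ker.1 (hl (Submodule.subset_span ⟨φ j, rfl⟩))
      rw [LinearMap.pi_apply_eq_sum_univ] at h1
      rw [← h1]
      refine Finset.sum_congr rfl fun r _ => ?_
      rw [smul_eq_mul]
      congr 2
      ext i
      simp [Pi.single_apply, eq_comm]
  refine hl0 (LinearMap.pi_ext' fun r => LinearMap.ext_ring ?_)
  simpa using congrFun h0 r

theorem exists_functional_of_coherence {I : Type*} {a k : ℕ} {μ : ℝ} (hμ0 : 0 ≤ μ)
    (hμ : 2 * k * μ ≤ 1) {x : I → Fin a → ℝ} (hx1 : ∀ i, x i ⬝ᵥ x i = 1)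
    (hx : ∀ i j, i ≠ j → |x i ⬝ᵥ x j| ≤ μ) (J : Finset I) (hJ : J.card ≤ k) (σ : I → ℝ)
    (hσ : ∀ i, |σ i| ≤ 1) :
    ∃ f : (Fin a → ℝ) →ₗ[ℝ] ℝ, (∀ j ∈ J, f (x j) = σ j) ∧ ∀ i ∉ J, |f (x i)| < 1 := by
  classical
  set T : (J → ℝ) →ₗ[ℝ] (J → ℝ) :=
    Matrix.mulVecLin (Matrix.of fun j i : J => x i ⬝ᵥ x j) with hT
  have hTapp : ∀ c j, T c j = ∑ i : J, c i * (x i ⬝ᵥ x j) := fun c j => by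
    simp [hT, Matrix.mulVec, dotProduct, mul_comm]
  have hJR : (J.card : ℝ) ≤ k := by exact_mod_cast hJ
  have hkey : ∀ c : J → ℝ, ‖c‖ + μ * ‖c‖ ≤ ‖T c‖ + k * (μ * ‖c‖) := by
    intro c
    have hz : 0 ≤ μ * ‖c‖ := by positivity
    have main : J.Nonempty → ‖c‖ ≤ ‖T c‖ + (k - 1) * (μ * ‖c‖) := by
      intro hne
      have hJ1 : (1 : ℝ) ≤ J.card := by exact_mod_cast hne.card_pos
      have hnn : 0 ≤ ((k : ℝ) - 1) * (μ * ‖c‖) := mul_nonneg (by linarith) hz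
      refine (pi_norm_le_iff_of_nonneg (by positivity)).2 fun j => ?_
      have h1 := hTapp c j
      rw [← Finset.add_sum_erase _ _ (Finset.mem_univ j), hx1, mul_one] at h1
      have h2 : |∑ i ∈ Finset.univ.erase j, c i * (x i ⬝ᵥ x j)| ≤ ((k : ℝ) - 1) * (μ * ‖c‖) := by
        refine (Finset.abs_sum_le_sum_abs _ _).trans ((Finset.sum_le_card_nsmul _ _ (μ * ‖c‖)
          fun i hi => ?_).trans ?_)
        · rw [abs_mul, mul_comm]
          exact mul_le_mul (hx _ _ fun h => Finset.ne_of_mem_erase hi (Subtype.ext h))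
            (norm_le_pi_norm c i) (abs_nonneg _) hμ0
        · rw [nsmul_eq_mul, Finset.card_erase_of_mem (Finset.mem_univ j), Finset.card_univ,
            Fintype.card_coe, Nat.cast_sub hne.card_pos, Nat.cast_one]
          exact mul_le_mul_of_nonneg_right (by linarith) hz
      have h3 : |T c j| ≤ ‖T c‖ := norm_le_pi_norm (T c) j
      rw [Real.norm_eq_abs, show c j = T c j - ∑ i ∈ Finset.univ.erase j, c i * (x i ⬝ᵥ x j) by
        rw [h1]; ring]
      exact (abs_sub _ _).trans (by linarith)
    rcases J.eq_empty_or_nonempty with rfl | hne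
    · have : c = 0 := Subsingleton.elim _ _
      simp [this]
    · linarith [main hne]
  have hinj : Function.Injective T := by
    rw [injective_iff_map_eq_zero]
    intro c hc
    have h1 := hkey c
    rw [hc, norm_zero] at h1
    have : ‖c‖ ≤ 0 := by nlinarith [norm_nonneg c]
    simpa using this
  obtain ⟨c, hc⟩ := LinearMap.injective_iff_surjective.1 hinj fun j => σ j
  set f : (Fin a → ℝ) →ₗ[ℝ] ℝ := ∑ i : J, c i • ∑ r, x i r • LinearMap.proj r with hf
  have happ : ∀ v, f v = ∑ i : J, c i * (x i ⬝ᵥ v) := fun v => by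
    simp [hf, dotProduct]
  refine ⟨f, fun j hj => ?_, fun i hi => ?_⟩
  · rw [happ, ← hTapp c ⟨j, hj⟩, hc]
  · have hz : 0 ≤ μ * ‖c‖ := by positivity
    have h1 := hkey c
    have h2 : ‖T c‖ ≤ 1 := by
      rw [hc]
      exact (pi_norm_le_iff_of_nonneg zero_le_one).2 fun j => hσ j
    have h3 : |f (x i)| ≤ k * (μ * ‖c‖) := by
      rw [happ]
      refine (Finset.abs_sum_le_sum_abs _ _).trans ((Finset.sum_le_card_nsmul _ _ (μ * ‖c‖)
        fun j _ => ?_).trans ?_)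
      · rw [abs_mul, mul_comm]
        exact mul_le_mul (hx _ _ fun h => hi (h ▸ j.2)) (norm_le_pi_norm c j) (abs_nonneg _) hμ0
      · rw [nsmul_eq_mul, Finset.card_univ, Fintype.card_coe]
        exact mul_le_mul_of_nonneg_right hJR hz
    refine h3.trans_lt ?_
    rcases hz.eq_or_lt with h0 | h0
    · simp [← h0]
    · nlinarith [norm_nonneg c]

theorem sum_exp_dotProduct_boolSign {a : ℕ} {t : ℝ} {u : Fin a → ℝ} (hu : ∀ i, |u i| = 1) :
    ∑ y : Fin a → Bool, Real.exp (t * (u ⬝ᵥ fun i => boolSign (y i))) =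
      (2 * Real.cosh t) ^ a := by
  have h1 : ∀ y : Fin a → Bool, Real.exp (t * (u ⬝ᵥ fun i => boolSign (y i))) =
      ∏ i, Real.exp (t * (u i * boolSign (y i))) := fun y => by
    rw [dotProduct, Finset.mul_sum, Real.exp_sum]
  have h2 : ∀ i, ∑ b : Bool, Real.exp (t * (u i * boolSign b)) = 2 * Real.cosh t := fun i => by
    rw [Fintype.sum_bool, Real.cosh_eq]
    rcases (abs_eq zero_le_one).1 (hu i) with h | h <;> simp [h, boolSign] <;> ring
  simp_rw [h1]
  rw [← Fintype.piFinset_univ, ← Finset.prod_univ_sum (fun _ => Finset.univ)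
    (fun i b => Real.exp (t * (u i * boolSign b)))]
  rw [Finset.prod_congr rfl fun i _ => h2 i]
  simp

theorem card_lt_abs_dotProduct_boolSign_le {a : ℕ} {μ : ℝ} (hμ : 0 ≤ μ) {u : Fin a → ℝ}
    (hu : ∀ i, |u i| = 1) :
    ((Finset.univ.filter fun y : Fin a → Bool =>
      μ * a < |u ⬝ᵥ fun i => boolSign (y i)|).card : ℝ) * Real.exp (a * μ ^ 2 / 2) ≤
      2 * 2 ^ a := by
  set B := Finset.univ.filter fun y : Fin a → Bool =>
      μ * a < |u ⬝ᵥ fun i => boolSign (y i)| with hB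
  have h1 : (B.card : ℝ) * Real.exp (a * μ ^ 2) ≤ 2 * (2 * Real.cosh μ) ^ a := by
    calc (B.card : ℝ) * Real.exp (a * μ ^ 2)
        ≤ ∑ y ∈ B, (Real.exp (μ * (u ⬝ᵥ fun i => boolSign (y i))) +
            Real.exp (-μ * (u ⬝ᵥ fun i => boolSign (y i)))) := by
          rw [← nsmul_eq_mul]
          refine Finset.card_nsmul_le_sum _ _ _ fun y hy => ?_
          have hy' : μ * a < |u ⬝ᵥ fun i => boolSign (y i)| := (Finset.mem_filter.1 hy).2
          have hm : a * μ ^ 2 ≤ μ * |u ⬝ᵥ fun i => boolSign (y i)| := by nlinarith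
          rcases abs_cases (u ⬝ᵥ fun i => boolSign (y i)) with ⟨h, -⟩ | ⟨h, -⟩
          · rw [h] at hm
            exact (Real.exp_le_exp.2 hm).trans (le_add_of_nonneg_right (Real.exp_pos _).le)
          · rw [h] at hm
            exact (Real.exp_le_exp.2 (by linarith)).trans
              (le_add_of_nonneg_left (Real.exp_pos _).le)
      _ ≤ ∑ y : Fin a → Bool, (Real.exp (μ * (u ⬝ᵥ fun i => boolSign (y i))) +
            Real.exp (-μ * (u ⬝ᵥ fun i => boolSign (y i)))) :=
          Finset.sum_le_univ_sum_of_nonneg fun _ =>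
            add_nonneg (Real.exp_pos _).le (Real.exp_pos _).le
      _ = 2 * (2 * Real.cosh μ) ^ a := by
          rw [Finset.sum_add_distrib, sum_exp_dotProduct_boolSign hu,
            sum_exp_dotProduct_boolSign hu, Real.cosh_neg]
          ring
  have h2 : (2 * Real.cosh μ) ^ a ≤ 2 ^ a * Real.exp (a * μ ^ 2 / 2) := by
    rw [mul_pow, mul_div_assoc, Real.exp_nat_mul]
    have := Real.cosh_pos μ
    gcongr
    exact Real.cosh_le_exp_half_sq μ
  have h3 : Real.exp (a * μ ^ 2) = Real.exp (a * μ ^ 2 / 2) * Real.exp (a * μ ^ 2 / 2) := by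
    rw [← Real.exp_add]
    ring_nf
  rw [h3] at h1
  have h4 := Real.exp_pos (a * μ ^ 2 / 2)
  refine le_of_mul_le_mul_right ?_ h4
  linarith

theorem exists_boolSign_code {a : ℕ} (ha : 0 < a) {μ : ℝ} (hμ0 : 0 ≤ μ) (hμ1 : μ < 1) :
    ∃ C : Finset (Fin a → Bool),
      (∀ x ∈ C, ∀ y ∈ C, x ≠ y →
        |(fun i => boolSign (x i)) ⬝ᵥ fun i => boolSign (y i)| ≤ μ * a) ∧
      Real.exp (a * μ ^ 2 / 2) ≤ 2 * C.card := by
  classical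
  obtain ⟨C, -, hC⟩ := Finite.exists_le_maximal (a := (∅ : Finset (Fin a → Bool)))
    (p := fun C => ∀ x ∈ C, ∀ y ∈ C, x ≠ y →
        |(fun i => boolSign (x i)) ⬝ᵥ fun i => boolSign (y i)| ≤ μ * a) (by simp)
  refine ⟨C, hC.prop, ?_⟩
  have hcover : ∀ y : Fin a → Bool, ∃ x ∈ C,
      μ * a < |(fun i => boolSign (x i)) ⬝ᵥ fun i => boolSign (y i)| := by
    intro y
    by_contra! hcon
    have hins : ∀ x ∈ insert y C, ∀ z ∈ insert y C, x ≠ z →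
        |(fun i => boolSign (x i)) ⬝ᵥ fun i => boolSign (z i)| ≤ μ * a := by
      intro x hx z hz hxz
      rcases Finset.mem_insert.1 hx with rfl | hx'
      · rcases Finset.mem_insert.1 hz with rfl | hz'
        · exact absurd rfl hxz
        · rw [dotProduct_comm]
          exact hcon z hz'
      · rcases Finset.mem_insert.1 hz with rfl | hz'
        · exact hcon x hx'
        · exact hC.prop x hx' z hz' hxz
    have hy : y ∈ C := hC.le_of_ge hins (Finset.subset_insert y C) (Finset.mem_insert_self y C)
    have h1 := hcon y hy
    have haR : (0 : ℝ) < a := by exact_mod_cast ha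
    simp only [dotProduct, boolSign_mul_self, Finset.sum_const, Finset.card_univ, Fintype.card_fin,
      nsmul_eq_mul, mul_one, abs_of_pos haR] at h1
    nlinarith
  have hcard : (2 : ℝ) ^ a ≤ ∑ x ∈ C, ((Finset.univ.filter fun y : Fin a → Bool =>
      μ * a < |(fun i => boolSign (x i)) ⬝ᵥ fun i => boolSign (y i)|).card : ℝ) := by
    have h1 : (Finset.univ : Finset (Fin a → Bool)).card ≤ _ :=
      (Finset.card_le_card (t := C.biUnion fun x => Finset.univ.filter fun y : Fin a → Bool =>
        μ * a < |(fun i => boolSign (x i)) ⬝ᵥ fun i => boolSign (y i)|) fun y _ => by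
          simpa using hcover y).trans Finset.card_biUnion_le
    rw [Finset.card_univ, Fintype.card_fun, Fintype.card_bool, Fintype.card_fin] at h1
    exact_mod_cast h1
  have h4 := Real.exp_pos (a * μ ^ 2 / 2)
  have h5 : (2 : ℝ) ^ a * Real.exp (a * μ ^ 2 / 2) ≤ C.card * (2 * 2 ^ a) := by
    refine (mul_le_mul_of_nonneg_right hcard h4.le).trans ?_
    rw [Finset.sum_mul, ← nsmul_eq_mul (C.card)]
    exact Finset.sum_le_card_nsmul _ _ _ fun x _ =>
      card_lt_abs_dotProduct_boolSign_le hμ0 fun i => abs_boolSign (x i)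
  have h6 : (0 : ℝ) < 2 ^ a := by positivity
  refine le_of_mul_le_mul_left ?_ h6
  linarith

/-- The standard basis vectors together with normalized sign vectors. -/
noncomputable def unitFamily {a : ℕ} (C : Finset (Fin a → Bool)) : Fin a ⊕ C → Fin a → ℝ
  | Sum.inl r => Pi.single r 1
  | Sum.inr c => (1 / √a) • fun i => boolSign (c.1 i)

theorem exists_incoherent_family {a k : ℕ} (hk : 1 ≤ k) (ha : 4 * k ^ 2 ≤ a) :
    ∃ C : Finset (Fin a → Bool), Real.exp (a / (8 * (k : ℝ) ^ 2)) ≤ 2 * C.card ∧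
      (∀ i, unitFamily C i ⬝ᵥ unitFamily C i = 1) ∧
      ∀ i j, i ≠ j → |unitFamily C i ⬝ᵥ unitFamily C j| ≤ 1 / (2 * (k : ℝ)) := by
  have hk1 : (1 : ℝ) ≤ k := by exact_mod_cast hk
  have haR : 4 * (k : ℝ) ^ 2 ≤ a := by exact_mod_cast ha
  have ha0 : (0 : ℝ) < a := by nlinarith
  have hsq : 2 * (k : ℝ) ≤ √a := Real.le_sqrt_of_sq_le (by nlinarith)
  have hsa : √(a : ℝ) * √a = a := Real.mul_self_sqrt ha0.le
  have hs0 : 0 < √(a : ℝ) := Real.sqrt_pos.2 ha0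
  obtain ⟨C, hC, hcard⟩ := exists_boolSign_code (a := a) (μ := 1 / (2 * (k : ℝ)))
    (by exact_mod_cast ha0) (by positivity) (by rw [div_lt_one] <;> linarith)
  have hmix : ∀ r (c : C), |unitFamily C (Sum.inl r) ⬝ᵥ unitFamily C (Sum.inr c)| ≤
      1 / (2 * (k : ℝ)) := fun r c => by
    simp only [unitFamily, single_dotProduct, one_mul, Pi.smul_apply, smul_eq_mul, abs_mul,
      abs_boolSign, mul_one]
    rw [abs_of_pos (by positivity)]
    exact one_div_le_one_div_of_le (by linarith) hsq
  refine ⟨C, ?_, ?_, ?_⟩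
  · refine le_trans (le_of_eq ?_) hcard
    congr 1
    field_simp
    norm_num
  · rintro (r | c)
    · simp [unitFamily]
    · simp only [unitFamily, smul_dotProduct, dotProduct_smul]
      simp only [dotProduct, boolSign_mul_self, Finset.sum_const, Finset.card_univ,
        Fintype.card_fin, nsmul_eq_mul, mul_one, smul_eq_mul]
      field_simp
      rw [sq, hsa]
  · rintro (r | c) (r' | c') hne
    · have hrr : r ≠ r' := fun h => hne (congrArg _ h)
      simp [unitFamily, hrr]
    · exact hmix r c'
    · rw [dotProduct_comm]
      exact hmix r' c
    · have hcc : c.1 ≠ c'.1 := fun h => hne (congrArg _ (Subtype.ext h))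
      have h1 := hC c.1 c.2 c'.1 c'.2 hcc
      simp only [unitFamily, smul_dotProduct, dotProduct_smul, smul_eq_mul]
      rw [← mul_assoc, abs_mul, abs_of_pos (by positivity), div_mul_div_comm, hsa, one_mul,
        one_div_mul_eq_div, div_le_iff₀ ha0]
      exact h1

theorem span_range_unitFamily {a : ℕ} (C : Finset (Fin a → Bool)) :
    Submodule.span ℝ (range (unitFamily C)) = ⊤ := by
  rw [eq_top_iff, ← (Pi.basisFun ℝ (Fin a)).span_eq, Submodule.span_le]
  rintro _ ⟨r, rfl⟩
  exact Submodule.subset_span ⟨Sum.inl r, by simp [unitFamily]⟩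

theorem card_powersetCard_pair_le {K : Type*} [Fintype K] [DecidableEq K] {n : ℕ} {p q : K}
    (hpq : p ≠ q) :
    ((Finset.univ.powersetCard (n + 2)).filter fun R : Finset K => p ∈ R ∧ q ∈ R).card ≤
      (Fintype.card K - 2).choose n := by
  have hsub : (Finset.univ.powersetCard (n + 2)).filter (fun R : Finset K => p ∈ R ∧ q ∈ R) ⊆
      (((Finset.univ \ {p, q}).powersetCard n).image fun S => S ∪ {p, q}) := by
    intro R hR
    obtain ⟨hRc, hp, hq⟩ := Finset.mem_filter.1 hR
    have hpair : ({p, q} : Finset K) ⊆ R := by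
      simp [Finset.insert_subset_iff, hp, hq]
    refine Finset.mem_image.2 ⟨R \ {p, q}, ?_, Finset.sdiff_union_of_subset hpair⟩
    rw [Finset.mem_powersetCard, Finset.card_sdiff_of_subset hpair, Finset.card_pair hpq,
      (Finset.mem_powersetCard.1 hRc).2]
    exact ⟨Finset.sdiff_subset_sdiff (Finset.subset_univ _) le_rfl, rfl⟩
  refine (Finset.card_le_card hsub).trans (Finset.card_image_le.trans ?_)
  rw [Finset.card_powersetCard, Finset.card_sdiff_of_subset (Finset.subset_univ _),
    Finset.card_pair hpq, Finset.card_univ]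

theorem card_not_injOn_fst_le (I B : Type*) [Fintype I] [Fintype B] [DecidableEq I]
    [DecidableEq B] (n : ℕ) :
    ((Finset.univ.powersetCard (n + 2)).filter fun R : Finset (I × B) =>
      ¬ Set.InjOn Prod.fst (R : Set (I × B))).card ≤
      Fintype.card I * Fintype.card B ^ 2 * (Fintype.card (I × B) - 2).choose n := by
  set pairs : Finset (I × B × B) := Finset.univ.filter fun t => t.2.1 ≠ t.2.2
  have hsub : ((Finset.univ.powersetCard (n + 2)).filter fun R : Finset (I × B) =>
      ¬ Set.InjOn Prod.fst (R : Set (I × B))) ⊆ pairs.biUnion fun t =>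
        (Finset.univ.powersetCard (n + 2)).filter fun R : Finset (I × B) =>
          (t.1, t.2.1) ∈ R ∧ (t.1, t.2.2) ∈ R := by
    intro R hR
    obtain ⟨hRc, hinj⟩ := Finset.mem_filter.1 hR
    simp only [Set.InjOn, not_forall] at hinj
    obtain ⟨⟨i, b⟩, hb, ⟨j, c⟩, hc, hij, hne⟩ := hinj
    obtain rfl : i = j := hij
    refine Finset.mem_biUnion.2 ⟨(i, b, c), ?_, Finset.mem_filter.2 ⟨hRc, hb, hc⟩⟩
    simpa [pairs] using hne
  refine (Finset.card_le_card hsub).trans ((Finset.card_biUnion_le_card_mul _ _ _ fun t ht =>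
    card_powersetCard_pair_le fun h => ?_).trans (Nat.mul_le_mul_right _ ?_))
  · exact (Finset.mem_filter.1 ht).2 (congrArg Prod.snd h)
  · refine (Finset.card_le_univ _).trans ?_
    simp [sq]

theorem mul_choose_le_ncard_injOn_fst (I B : Type*) [Fintype I] [Fintype B] [Nonempty I] {k : ℕ}
    (hk : 2 ≤ k) (hN : k ≤ Fintype.card (I × B)) :
    (1 - (k : ℝ) ^ 2 / Fintype.card I) * ((Fintype.card (I × B)).choose k) ≤
      ({R : Finset (I × B) | R.card = k ∧ Set.InjOn Prod.fst (R : Set (I × B))}.ncard : ℝ) := by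
  classical
  obtain ⟨n, rfl⟩ := Nat.exists_eq_add_of_le' hk
  have hset : {R : Finset (I × B) | R.card = n + 2 ∧ Set.InjOn Prod.fst (R : Set (I × B))} =
      ((Finset.univ.powersetCard (n + 2)).filter fun R : Finset (I × B) =>
        Set.InjOn Prod.fst (R : Set (I × B)) : Finset (Finset (I × B))) := by
    ext R
    simp [Finset.mem_powersetCard]
  rw [hset, Set.ncard_coe_finset]
  have hsplit := Finset.card_filter_add_card_filter_not (s := Finset.univ.powersetCard (n + 2))
    fun R : Finset (I × B) => Set.InjOn Prod.fst (R : Set (I × B))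
  have hbad := card_not_injOn_fst_le I B n
  rw [Finset.card_powersetCard, Finset.card_univ] at hsplit
  set good := ((Finset.univ.powersetCard (n + 2)).filter fun R : Finset (I × B) =>
    Set.InjOn Prod.fst (R : Set (I × B))).card
  set bad := ((Finset.univ.powersetCard (n + 2)).filter fun R : Finset (I × B) =>
    ¬ Set.InjOn Prod.fst (R : Set (I × B))).card
  have hNeq : Fintype.card (I × B) = Fintype.card I * Fintype.card B := Fintype.card_prod I B
  set m := Fintype.card I with hm
  set b := Fintype.card B
  obtain ⟨L, hL⟩ := Nat.exists_eq_add_of_le' (hk.trans hN)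
  rw [hL] at hsplit hbad hN hNeq ⊢
  have hm0 : (0 : ℝ) < m := by exact_mod_cast Fintype.card_pos
  have hc1 : (L + 2) * (L + 1).choose (n + 1) = (L + 2).choose (n + 2) * (n + 2) :=
    Nat.add_one_mul_choose_eq (L + 1) (n + 1)
  have hc2 : (L + 1) * L.choose n = (L + 1).choose (n + 1) * (n + 1) :=
    Nat.add_one_mul_choose_eq L n
  have hbad' : bad ≤ m * b ^ 2 * L.choose n := by simpa using hbad
  have hnL : (n : ℝ) ≤ L := by
    have : n ≤ L := by omega
    exact_mod_cast this
  rify at hsplit hbad' hc1 hc2 hNeq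
  push_cast
  set c := ((L + 2).choose (n + 2) : ℝ)
  have hc0 : 0 ≤ c := Nat.cast_nonneg _
  have h1 : (L + 1 : ℝ) * (m * bad) ≤ (L + 1) * ((n + 2) ^ 2 * c) := by
    calc (L + 1 : ℝ) * (m * bad) ≤ (L + 1) * (m * (m * b ^ 2 * L.choose n)) := by gcongr
      _ = (m * b) ^ 2 * ((L + 1) * L.choose n) := by ring
      _ = (L + 2) * (n + 1) * (n + 2) * c := by
          rw [hc2, ← hNeq]
          linear_combination (L + 2 : ℝ) * (n + 1) * hc1
      _ ≤ (L + 1) * ((n + 2) ^ 2 * c) := by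
          have : (L + 2 : ℝ) * (n + 1) * (n + 2) ≤ (L + 1) * (n + 2) ^ 2 := by nlinarith
          nlinarith
  have h2 := le_of_mul_le_mul_left h1 (by positivity)
  have h3 : (bad : ℝ) ≤ (n + 2) ^ 2 / m * c := by
    rw [div_mul_eq_mul_div, le_div_iff₀ hm0]
    linarith
  linarith

theorem exists_polytope_with_many_vertices {d M : ℕ} (hd : 3 ≤ d) (hM : 3 ≤ M) :
    ∃ P : Set (Fin d → ℝ), IsPolytope P ∧ P = -P ∧ affineSpan ℝ P = ⊤ ∧
      (P.extremePoints ℝ).ncard = (d - 2) * (2 * M) := by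
  have hne : Nonempty (Fin (d - 2)) := ⟨⟨0, by omega⟩⟩
  have hs : Function.Injective fun i : Fin (d - 2) => (i : ℝ) := fun i j h => by
    simpa [Fin.ext_iff] using h
  obtain ⟨P, h₁, h₂, h₃, h₄, -⟩ := exists_polytope_of_clusters (d := d) (n := 0) (M := M)
    (x := fun i : Fin (d - 2) => (Pi.single i 1 : Fin (d - 2) → ℝ))
    (y := fun i (r : Fin 1) => (i : ℝ) ^ (r : ℕ))
    (by rw [Module.finrank_fin_fun, Module.finrank_fin_fun]; omega) hM
    (exists_functional_of_coherence (k := 1) (μ := 0) le_rfl (by norm_num) (fun i => by simp)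
      fun i j hij => by simp [hij])
    (exists_functional_vandermonde hs)
    (by
      rw [← (Pi.basisFun ℝ (Fin (d - 2))).span_eq]
      congr 2
      ext i
      simp)
    (span_range_vandermonde hs (by rw [Fintype.card_fin]; omega))
  exact ⟨P, h₁, h₂, h₃, by rw [h₄, Fintype.card_fin]⟩

theorem exists_polytope_with_many_faces {d k M : ℕ} (hk : 1 ≤ k) (hd : 4 * k ^ 2 + 2 * k ≤ d)
    (hM : 3 ≤ M) :
    ∃ C : Finset (Fin (d - 2 * k) → Bool),
      Real.exp ((d - 2 * k : ℕ) / (8 * (k : ℝ) ^ 2)) ≤ 2 * C.card ∧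
      ∃ P : Set (Fin d → ℝ), IsPolytope P ∧ P = -P ∧ affineSpan ℝ P = ⊤ ∧
        (P.extremePoints ℝ).ncard = Fintype.card (Fin (d - 2 * k) ⊕ C) * (2 * M) ∧
        {R : Finset ((Fin (d - 2 * k) ⊕ C) × Bool × Fin M) | R.card = k ∧
          Set.InjOn Prod.fst (R : Set ((Fin (d - 2 * k) ⊕ C) × Bool × Fin M))}.ncard ≤
          faceCount P (k - 1) := by
  obtain ⟨n, rfl⟩ := Nat.exists_eq_add_of_le' hk
  obtain ⟨C, hC, hx1, hx⟩ := exists_incoherent_family (a := d - 2 * (n + 1)) hk (by omega)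
  have hk2 : n + 1 ≤ (n + 1) ^ 2 := by nlinarith
  have hne : Nonempty (Fin (d - 2 * (n + 1)) ⊕ C) := ⟨Sum.inl ⟨0, by omega⟩⟩
  have hs : Function.Injective fun i : Fin (d - 2 * (n + 1)) ⊕ C =>
      (Fintype.equivFin _ i : ℝ) := fun i j h =>
    (Fintype.equivFin _).injective (Fin.ext (Nat.cast_injective (R := ℝ) h))
  exact ⟨C, hC, exists_polytope_of_clusters (x := unitFamily C)
    (y := fun i (r : Fin (n + 1)) => (Fintype.equivFin _ i : ℝ) ^ (r : ℕ))
    (by rw [Module.finrank_fin_fun, Module.finrank_fin_fun]; omega) hM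
    (exists_functional_of_coherence (μ := 1 / (2 * ((n + 1 : ℕ) : ℝ))) (by positivity)
      (by field_simp; exact le_rfl) hx1 hx)
    (exists_functional_vandermonde hs) (span_range_unitFamily C)
    (span_range_vandermonde hs (by
      rw [Fintype.card_sum, Fintype.card_fin]
      omega))⟩

theorem stmt8 {d k : ℕ} (hk : 3 ≤ k) (hkd : 2 * k ≤ d) (N₀ : ℕ) :
    ∃ N : ℕ, N₀ ≤ N ∧
      ∃ P : Set (Fin d → ℝ),
        IsPolytope P ∧ P = -P ∧ affineSpan ℝ P = ⊤ ∧
        (P.extremePoints ℝ).ncard = N ∧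
        (1 - (k : ℝ) ^ 2 * (2 : ℝ) ^ (-(3 * (d : ℝ)) / (20 * (k : ℝ) ^ 2 * 2 ^ k))) *
            (N.choose k) ≤ (faceCount P (k - 1) : ℝ) := by
  have hkR : (3 : ℝ) ≤ k := by exact_mod_cast hk
  have h2k : (8 : ℝ) ≤ 2 ^ k := by
    calc (8 : ℝ) = 2 ^ 3 := by norm_num
      _ ≤ 2 ^ k := pow_le_pow_right₀ (by norm_num) hk
  have hexp : 3 * (d : ℝ) / (20 * (k : ℝ) ^ 2 * 2 ^ k) ≤ 3 * d / (160 * (k : ℝ) ^ 2) := by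
    refine div_le_div_of_nonneg_left (by positivity) (by positivity) ?_
    linarith [mul_le_mul_of_nonneg_left h2k (by positivity : (0 : ℝ) ≤ 20 * (k : ℝ) ^ 2)]
  rw [neg_div]
  set ε := 3 * (d : ℝ) / (20 * (k : ℝ) ^ 2 * 2 ^ k) with hε
  rcases le_or_gt d (160 * k ^ 2) with hd | hd
  · obtain ⟨P, h₁, h₂, h₃, h₄⟩ := exists_polytope_with_many_vertices (d := d) (by omega)
      (M := max 3 N₀) (le_max_left _ _)
    refine ⟨(d - 2) * (2 * max 3 N₀), ?_, P, h₁, h₂, h₃, h₄, ?_⟩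
    · have : N₀ ≤ max 3 N₀ := le_max_right _ _
      nlinarith [show 1 ≤ d - 2 by omega]
    · refine le_trans (mul_nonpos_of_nonpos_of_nonneg ?_ (Nat.cast_nonneg _)) (Nat.cast_nonneg _)
      have hdR : (d : ℝ) ≤ 160 * (k : ℝ) ^ 2 := by exact_mod_cast hd
      have hε3 : ε ≤ 3 := hexp.trans (by rw [div_le_iff₀ (by positivity)]; linarith)
      have hpow : (1 / 8 : ℝ) ≤ 2 ^ (-ε) := by
        calc (1 / 8 : ℝ) = 2 ^ (-3 : ℝ) := by
              rw [Real.rpow_neg (by norm_num)]; norm_num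
          _ ≤ 2 ^ (-ε) := Real.rpow_le_rpow_of_exponent_le (by norm_num) (by linarith)
      nlinarith
  · have hk2 : 9 ≤ k ^ 2 := by nlinarith
    have hkk : 3 * k ≤ k ^ 2 := by nlinarith
    obtain ⟨C, hC, P, h₁, h₂, h₃, h₄, h₅⟩ := exists_polytope_with_many_faces (d := d) (k := k)
      (M := N₀ + k) (by omega) (by omega) (by omega)
    have hNe : Nonempty (Fin (d - 2 * k) ⊕ C) := ⟨Sum.inl ⟨0, by omega⟩⟩
    set I := Fin (d - 2 * k) ⊕ C with hI
    have hcardI : 1 ≤ Fintype.card I := Fintype.card_pos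
    have hN : Fintype.card (I × Bool × Fin (N₀ + k)) = Fintype.card I * (2 * (N₀ + k)) := by
      simp
    have hle : N₀ + k ≤ Fintype.card I * (2 * (N₀ + k)) := by nlinarith
    refine ⟨Fintype.card I * (2 * (N₀ + k)), by omega, P, h₁, h₂, h₃, h₄, ?_⟩
    have hcount := mul_choose_le_ncard_injOn_fst I (Bool × Fin (N₀ + k)) (k := k) (by omega)
      (by omega)
    rw [hN] at hcount
    refine le_trans ?_ (hcount.trans (by exact_mod_cast h₅))
    refine mul_le_mul_of_nonneg_right ?_ (Nat.cast_nonneg _)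
    have hdR : 160 * (k : ℝ) ^ 2 ≤ d := by exact_mod_cast hd.le
    have hεa : ε + 1 ≤ ((d - 2 * k : ℕ) : ℝ) / (8 * (k : ℝ) ^ 2) := by
      have : 3 * (d : ℝ) / (160 * (k : ℝ) ^ 2) + 1 ≤
          ((d - 2 * k : ℕ) : ℝ) / (8 * (k : ℝ) ^ 2) := by
        rw [Nat.cast_sub hkd, div_add_one (by positivity),
          div_le_div_iff₀ (by positivity) (by positivity)]
        have h : 3 * (d : ℝ) + 160 * (k : ℝ) ^ 2 ≤ 20 * (d - 2 * k) := by nlinarith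
        push_cast
        linarith [mul_le_mul_of_nonneg_right h (by positivity : (0 : ℝ) ≤ 8 * (k : ℝ) ^ 2)]
      linarith
    have h2e : (2 : ℝ) ≤ Real.exp 1 := by linarith [Real.add_one_le_exp (1 : ℝ)]
    have hε0 : 0 ≤ ε := by positivity
    have hpow : (2 : ℝ) ^ ε ≤ Fintype.card I := by
      have h6 : (2 : ℝ) ^ ε ≤ Real.exp ε := by
        rw [← Real.exp_one_rpow]
        exact Real.rpow_le_rpow (by norm_num) h2e hε0
      have h7 : Real.exp ε * 2 ≤ 2 * C.card := by
        refine le_trans ?_ ((Real.exp_le_exp.2 hεa).trans hC)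
        rw [Real.exp_add]
        gcongr
      have h8 : (C.card : ℝ) ≤ Fintype.card I := by
        have : C.card ≤ Fintype.card I := by simp [hI]
        exact_mod_cast this
      linarith
    rw [Real.rpow_neg (by norm_num), ← div_eq_mul_inv]
    have hpos : (0 : ℝ) < 2 ^ ε := by positivity
    gcongr
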